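/- Let φ : ℝ → ℂ be a smooth compactly supported function, and define ψ : ℝ → ℂ by ψ(x) = (2π)^{−1} ∫_ℝ φ(ξ) e^{ixξ} dξ (so that the Fourier transform of ψ is φ). Then ψ belongs to the class 𝒜. -/

import Mathlib

/-- A function `f : ℝ → ℂ` is a Schwartz function: it is smooth and each function
`x ↦ |x|^k ‖f⁽ⁿ⁾(x)‖` is bounded on `ℝ`. -/
def IsSchwartz (f : ℝ → ℂ) : Prop :=
  ContDiff ℝ (⊤ : ℕ∞) f ∧ ∀ k n : ℕ, ∃ C : ℝ, ∀ x : ℝ, |x| ^ k * ‖iteratedDeriv n f x‖ ≤ C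

/-- The class `𝒜` of the paper: functions `ψ : ℝ → ℂ` extending to an entire function
`Ψ : ℂ → ℂ` such that each horizontal translate `x ↦ Ψ(x + iy)` is a Schwartz function,
with Schwartz seminorms uniformly bounded for `y` in any compact subset of `ℝ`. -/
def MemA (ψ : ℝ → ℂ) : Prop :=
  ∃ Ψ : ℂ → ℂ,
    Differentiable ℂ Ψ ∧
    (∀ x : ℝ, Ψ (x : ℂ) = ψ x) ∧
    (∀ y : ℝ, IsSchwartz fun x : ℝ => Ψ (x + y * Complex.I)) ∧
    (∀ K : Set ℝ, IsCompact K → ∀ k n : ℕ, ∃ C : ℝ, ∀ y ∈ K, ∀ x : ℝ,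
      |x| ^ k * ‖iteratedDeriv n (fun x : ℝ => Ψ (x + y * Complex.I)) x‖ ≤ C)

/-- The Fourier-Laplace transform `z ↦ ∫ φ(ξ) e^{izξ} dξ`. -/
noncomputable def fourierLaplace (φ : ℝ → ℂ) (z : ℂ) : ℂ :=
  ∫ ξ : ℝ, φ ξ * Complex.exp (Complex.I * z * ξ)

lemma norm_exp_I_mul_le (z : ℂ) (ξ : ℝ) {M : ℝ} (hM : |z.im| ≤ M) :
    ‖Complex.exp (Complex.I * z * ξ)‖ ≤ Real.exp (M * |ξ|) := by
  rw [Complex.norm_exp]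
  have hre : (Complex.I * z * ξ).re = -(z.im * ξ) := by simp
  rw [hre, Real.exp_le_exp]
  calc -(z.im * ξ) ≤ |z.im * ξ| := neg_le_abs _
    _ = |z.im| * |ξ| := abs_mul _ _
    _ ≤ M * |ξ| := by gcongr

lemma norm_fourierLaplace_le {φ : ℝ → ℂ} (hφ : Continuous φ) (hsupp : HasCompactSupport φ)
    {z : ℂ} {M : ℝ} (hM : |z.im| ≤ M) :
    ‖fourierLaplace φ z‖ ≤ ∫ ξ : ℝ, ‖φ ξ‖ * Real.exp (M * |ξ|) := by
  refine MeasureTheory.norm_integral_le_of_norm_le ?_ (.of_forall fun ξ => ?_)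
  · exact Continuous.integrable_of_hasCompactSupport (by fun_prop) hsupp.norm.mul_right
  · rw [norm_mul]
    gcongr
    exact norm_exp_I_mul_le z ξ hM

lemma hasDerivAt_fourierLaplace {φ : ℝ → ℂ} (hφ : Continuous φ) (hsupp : HasCompactSupport φ)
    (z : ℂ) :
    HasDerivAt (fourierLaplace φ) (fourierLaplace (fun ξ => φ ξ * (Complex.I * ξ)) z) z := by
  refine (hasDerivAt_integral_of_dominated_loc_of_deriv_le (μ := MeasureTheory.volume)
    (F := fun (w : ℂ) (ξ : ℝ) => φ ξ * Complex.exp (Complex.I * w * ξ))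
    (F' := fun (w : ℂ) (ξ : ℝ) => φ ξ * (Complex.I * ξ) * Complex.exp (Complex.I * w * ξ))
    (bound := fun ξ : ℝ => ‖φ ξ * (Complex.I * ξ)‖ * Real.exp ((‖z‖ + 1) * |ξ|))
    (Metric.ball_mem_nhds z one_pos) (.of_forall fun w => ?_) ?_ ?_
    (.of_forall fun ξ w hw => ?_) ?_ (.of_forall fun ξ w _ => ?_)).2
  · exact Continuous.aestronglyMeasurable (by fun_prop)
  · exact Continuous.integrable_of_hasCompactSupport (by fun_prop) hsupp.mul_right
  · exact Continuous.aestronglyMeasurable (by fun_prop)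
  · rw [norm_mul]
    gcongr
    refine norm_exp_I_mul_le w ξ ((Complex.abs_im_le_norm w).trans ?_)
    have h := norm_le_norm_add_norm_sub z w
    rw [norm_sub_rev, ← dist_eq_norm] at h
    linarith [Metric.mem_ball.1 hw]
  · exact Continuous.integrable_of_hasCompactSupport (by fun_prop)
      (hsupp.mul_right (f' := fun ξ : ℝ => Complex.I * (ξ : ℂ))).norm.mul_right
  · have h : HasDerivAt (fun w : ℂ => Complex.I * w * ξ) (Complex.I * ξ) w := by
      simpa using ((hasDerivAt_id w).const_mul Complex.I).mul_const (ξ : ℂ)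
    exact (h.cexp.const_mul (φ ξ)).congr_deriv (by ring)

lemma fourierLaplace_deriv {φ : ℝ → ℂ} (hφ : ContDiff ℝ (⊤ : ℕ∞) φ) (hsupp : HasCompactSupport φ)
    (z : ℂ) : fourierLaplace (deriv φ) z = -(Complex.I * z * fourierLaplace φ z) := by
  have hφ' : Continuous (deriv φ) := hφ.continuous_deriv (by simp)
  have hφc : Continuous φ := hφ.continuous
  have hexp (ξ : ℝ) : HasDerivAt (fun ξ : ℝ => Complex.exp (Complex.I * z * ξ))
      (Complex.exp (Complex.I * z * ξ) * (Complex.I * z)) ξ := by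
    have h : HasDerivAt (fun ξ : ℝ => Complex.I * z * (ξ : ℂ)) (Complex.I * z) ξ := by
      simpa using (Complex.ofRealCLM.hasDerivAt (x := ξ)).const_mul (Complex.I * z)
    exact h.cexp
  have key := MeasureTheory.integral_mul_deriv_eq_deriv_mul_of_integrable
    (u := φ) (u' := deriv φ) (v := fun ξ : ℝ => Complex.exp (Complex.I * z * ξ))
    (v' := fun ξ : ℝ => Complex.exp (Complex.I * z * ξ) * (Complex.I * z))
    (fun ξ _ => (hφ.differentiable (by simp) ξ).hasDerivAt) (fun ξ _ => hexp ξ)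
    (Continuous.integrable_of_hasCompactSupport (by fun_prop) hsupp.mul_right)
    (Continuous.integrable_of_hasCompactSupport (by fun_prop) hsupp.deriv.mul_right)
    (Continuous.integrable_of_hasCompactSupport (by fun_prop) hsupp.mul_right)
  simp only [← mul_assoc, MeasureTheory.integral_mul_const] at key
  unfold fourierLaplace
  linear_combination key

lemma norm_pow_mul_norm_fourierLaplace {φ : ℝ → ℂ} (hφ : ContDiff ℝ (⊤ : ℕ∞) φ)
    (hsupp : HasCompactSupport φ) (k : ℕ) (z : ℂ) :
    ‖z‖ ^ k * ‖fourierLaplace φ z‖ = ‖fourierLaplace (deriv^[k] φ) z‖ := by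
  induction k generalizing φ with
  | zero => simp
  | succ k ih =>
    rw [Function.iterate_succ_apply, ← ih (contDiff_infty_iff_deriv.1 hφ).2 hsupp.deriv,
      fourierLaplace_deriv hφ hsupp]
    simp [pow_succ, mul_assoc]

lemma exists_bound_fourierLaplace {φ : ℝ → ℂ} (hφ : ContDiff ℝ (⊤ : ℕ∞) φ)
    (hsupp : HasCompactSupport φ) (k : ℕ) (M : ℝ) :
    ∃ C : ℝ, ∀ z : ℂ, |z.im| ≤ M → ‖z‖ ^ k * ‖fourierLaplace φ z‖ ≤ C := by
  have h : ContDiff ℝ (⊤ : ℕ∞) (deriv^[k] φ) ∧ HasCompactSupport (deriv^[k] φ) := by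
    induction k with
    | zero => exact ⟨hφ, hsupp⟩
    | succ k ih =>
      rw [Function.iterate_succ_apply']
      exact ⟨(contDiff_infty_iff_deriv.1 ih.1).2, ih.2.deriv⟩
  refine ⟨∫ ξ : ℝ, ‖deriv^[k] φ ξ‖ * Real.exp (M * |ξ|), fun z hz => ?_⟩
  rw [norm_pow_mul_norm_fourierLaplace hφ hsupp]
  exact norm_fourierLaplace_le h.1.continuous h.2 hz

lemma iteratedDeriv_fourierLaplace_horizontal {φ : ℝ → ℂ} (hφ : Continuous φ)
    (hsupp : HasCompactSupport φ) (n : ℕ) (y : ℝ) :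
    iteratedDeriv n (fun x : ℝ => fourierLaplace φ (x + y * Complex.I)) =
      fun x : ℝ => fourierLaplace (fun ξ => φ ξ * (Complex.I * ξ) ^ n) (x + y * Complex.I) := by
  induction n generalizing φ with
  | zero => simp
  | succ n ih =>
    have hderiv : deriv (fun x : ℝ => fourierLaplace φ (x + y * Complex.I)) =
        fun x : ℝ => fourierLaplace (fun ξ => φ ξ * (Complex.I * ξ)) (x + y * Complex.I) := by
      funext x
      exact ((hasDerivAt_fourierLaplace hφ hsupp _).comp_add_const (x : ℂ)
        (y * Complex.I)).comp_ofReal.deriv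
    rw [iteratedDeriv_succ', hderiv,
      ih (φ := fun ξ => φ ξ * (Complex.I * ξ)) (by fun_prop) hsupp.mul_right]
    simp only [pow_succ', mul_assoc]

lemma exists_bound_iteratedDeriv_fourierLaplace {φ : ℝ → ℂ} (hφ : ContDiff ℝ (⊤ : ℕ∞) φ)
    (hsupp : HasCompactSupport φ) (k n : ℕ) (M : ℝ) :
    ∃ C : ℝ, ∀ y : ℝ, |y| ≤ M → ∀ x : ℝ,
      |x| ^ k * ‖iteratedDeriv n (fun x : ℝ => fourierLaplace φ (x + y * Complex.I)) x‖ ≤ C := by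
  have hmul : ContDiff ℝ (⊤ : ℕ∞) fun ξ : ℝ => φ ξ * (Complex.I * (ξ : ℂ)) ^ n :=
    hφ.mul ((contDiff_const.mul Complex.ofRealCLM.contDiff).pow n)
  obtain ⟨C, hC⟩ := exists_bound_fourierLaplace hmul hsupp.mul_right k M
  refine ⟨C, fun y hy x => ?_⟩
  rw [iteratedDeriv_fourierLaplace_horizontal hφ.continuous hsupp]
  refine le_trans ?_ (hC (x + y * Complex.I) (by simpa using hy))
  gcongr
  simpa using Complex.abs_re_le_norm (x + y * Complex.I)

lemma memA_fourierLaplace {φ : ℝ → ℂ} (hφ : ContDiff ℝ (⊤ : ℕ∞) φ)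
    (hsupp : HasCompactSupport φ) : MemA fun x : ℝ => fourierLaplace φ x := by
  have hdiff : Differentiable ℂ (fourierLaplace φ) := fun z =>
    (hasDerivAt_fourierLaplace hφ.continuous hsupp z).differentiableAt
  refine ⟨fourierLaplace φ, hdiff, fun _ => rfl, fun y => ⟨?_, fun k n => ?_⟩,
    fun K hK k n => ?_⟩
  · exact (hdiff.contDiff.restrict_scalars ℝ).comp
      (Complex.ofRealCLM.contDiff.add contDiff_const)
  · obtain ⟨C, hC⟩ := exists_bound_iteratedDeriv_fourierLaplace hφ hsupp k n |y|
    exact ⟨C, hC y le_rfl⟩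
  · obtain ⟨M, hM⟩ := hK.isBounded.exists_norm_le
    obtain ⟨C, hC⟩ := exists_bound_iteratedDeriv_fourierLaplace hφ hsupp k n M
    exact ⟨C, fun y hy => hC y (hM y hy)⟩

/-- If `φ : ℝ → ℂ` is smooth and compactly supported, then the function
`ψ(x) = (2π)⁻¹ ∫ φ(ξ) e^{ixξ} dξ` (whose Fourier transform is `φ`) belongs to the class `𝒜`. -/
theorem memA_of_compactly_supported_fourier_transform
    (φ : ℝ → ℂ) (hφ : ContDiff ℝ (⊤ : ℕ∞) φ) (hsupp : HasCompactSupport φ) :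
    MemA fun x : ℝ =>
      (2 * (Real.pi : ℂ))⁻¹ * ∫ ξ : ℝ, φ ξ * Complex.exp (Complex.I * x * ξ) := by
  have h := memA_fourierLaplace (φ := fun ξ => (2 * (Real.pi : ℂ))⁻¹ * φ ξ)
    (contDiff_const.mul hφ) hsupp.mul_left
  simpa only [fourierLaplace, mul_assoc, MeasureTheory.integral_const_mul] using h
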